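/- Any Sperner labelling of the pile Π_d(n_1,...,n_d) by vertices of the unit cube {0,1}^d contains at least one centrally labelled cell, i.e., a cell of the cubical complex on whose interior the induced multilinear map attains the value (1/2,...,1/2). -/

import Mathlib

/-- The point of `[0,1]^d` corresponding to a label in `{0,1}^d`. -/
def labelPt {d : ℕ} (u : Fin d → Bool) : Fin d → ℝ := fun j => if u j then 1 else 0

/-- The multilinear map induced by the labelling `L` on the cell of the pile
with base vertex `p` and set `S` of free directions, evaluated at the local
coordinates `t` (only the coordinates in `S` are used). -/
def cellExt {d : ℕ} (L : (Fin d → ℕ) → Fin d → Bool) (p : Fin d → ℕ)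
    (S : Finset (Fin d)) (t : Fin d → ℝ) : Fin d → ℝ :=
  ∑ w : Fin d → Bool,
    (∏ j, if j ∈ S then (if w j then t j else 1 - t j) else (if w j then 0 else 1)) •
      labelPt (L fun j => p j + if w j then 1 else 0)


/-- Sum over monotone lattice paths from `v` using exactly the directions of `S`. -/
def pathW {d : ℕ} : List ((Fin d → ℕ) → ZMod 2) → (Fin d → ℕ) → Finset (Fin d) → ZMod 2
  | [], _, S => if S = ∅ then 1 else 0
  | a :: l, v, S =>
      ∑ i ∈ S, (a (v + Pi.single i 1) + a v) * pathW l (v + Pi.single i 1) (S.erase i)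

theorem sum_symm_zero {α : Type*} [DecidableEq α] (S : Finset α) (F : α → α → ZMod 2)
    (hF : ∀ i k, F i k = F k i) : ∑ i ∈ S, ∑ k ∈ S.erase i, F i k = 0 := by
  rw [Finset.sum_sigma']
  refine Finset.sum_involution (fun x _ => ⟨x.2, x.1⟩) ?_ ?_ ?_ ?_
  · rintro ⟨i, k⟩ _
    simp only
    rw [hF k i]
    exact CharTwo.add_self_eq_zero _
  · rintro ⟨i, k⟩ h _ heq
    simp only [Finset.mem_sigma, Finset.mem_erase] at h
    simp only [Sigma.mk.injEq] at heq
    exact h.2.1 heq.1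
  · rintro ⟨i, k⟩ h
    simp only [Finset.mem_sigma, Finset.mem_erase] at h ⊢
    exact ⟨h.2.2, fun e => h.2.1 e.symm, h.1⟩
  · rintro ⟨i, k⟩ h
    rfl

theorem sum_erase_comm {α : Type*} [DecidableEq α] (S : Finset α) (F : α → α → ZMod 2) :
    ∑ i ∈ S, ∑ k ∈ S.erase i, F i k = ∑ i ∈ S, ∑ k ∈ S.erase i, F k i := by
  refine Finset.sum_comm' ?_
  intro x y
  simp only [Finset.mem_erase]
  tauto

theorem pathW_closed {d : ℕ} (l : List ((Fin d → ℕ) → ZMod 2)) :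
    ∀ (v : Fin d → ℕ) (S : Finset (Fin d)),
      ∑ i ∈ S, (pathW l (v + Pi.single i 1) (S.erase i) + pathW l v (S.erase i)) = 0 := by
  induction l with
  | nil =>
    intro v S
    refine Finset.sum_eq_zero fun i _ => ?_
    simp only [pathW]
    exact CharTwo.add_self_eq_zero _
  | cons a l ih =>
    intro v S
    have h1 : ∑ i ∈ S, ∑ k ∈ S.erase i, a (v + Pi.single i 1 + Pi.single k 1) *
        pathW l (v + Pi.single i 1 + Pi.single k 1) ((S.erase i).erase k) = 0 := by
      apply sum_symm_zero
      intro i k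
      rw [add_right_comm, Finset.erase_right_comm]
    have h2 : ∑ i ∈ S, ∑ k ∈ S.erase i, a (v + Pi.single i 1) *
        (pathW l (v + Pi.single i 1 + Pi.single k 1) ((S.erase i).erase k)
          + pathW l (v + Pi.single i 1) ((S.erase i).erase k)) = 0 := by
      refine Finset.sum_eq_zero fun i _ => ?_
      rw [← Finset.mul_sum, ih, mul_zero]
    have h3 : ∑ i ∈ S, ∑ k ∈ S.erase i, a v * pathW l v ((S.erase i).erase k) = 0 := by
      apply sum_symm_zero
      intro i k
      rw [Finset.erase_right_comm]
    have h4 : ∑ i ∈ S, ∑ k ∈ S.erase i, a v *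
        (pathW l (v + Pi.single k 1) ((S.erase i).erase k)
          + pathW l v ((S.erase i).erase k)) = 0 := by
      refine Finset.sum_eq_zero fun i _ => ?_
      rw [← Finset.mul_sum, ih, mul_zero]
    have h5 : ∑ i ∈ S, ∑ k ∈ S.erase i, a (v + Pi.single i 1) *
          pathW l (v + Pi.single i 1) ((S.erase i).erase k)
        = ∑ i ∈ S, ∑ k ∈ S.erase i, a (v + Pi.single k 1) *
          pathW l (v + Pi.single k 1) ((S.erase i).erase k) := by
      rw [sum_erase_comm]
      simp only [Finset.erase_right_comm]
    simp only [pathW, Finset.sum_add_distrib, mul_add, add_mul] at *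
    linear_combination h1 + h2 - h5 + h4 - h3

theorem pathW_cons {d : ℕ} (a : (Fin d → ℕ) → ZMod 2) (l : List ((Fin d → ℕ) → ZMod 2))
    (v : Fin d → ℕ) (S : Finset (Fin d)) :
    pathW (a :: l) v S = ∑ i ∈ S, (a (v + Pi.single i 1) * pathW l (v + Pi.single i 1) (S.erase i)
      - a v * pathW l v (S.erase i)) := by
  have h := pathW_closed l v S
  have h' : ∑ i ∈ S, a v * (pathW l (v + Pi.single i 1) (S.erase i) + pathW l v (S.erase i)) = 0 := by
    rw [← Finset.mul_sum, h, mul_zero]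
  simp only [pathW, Finset.sum_add_distrib, Finset.sum_sub_distrib, mul_add, add_mul] at *
  linear_combination h'

theorem pathW_ne {d : ℕ} (l : List ((Fin d → ℕ) → ZMod 2)) :
    ∀ (v : Fin d → ℕ) (S : Finset (Fin d)), pathW l v S ≠ 0 → ∀ a ∈ l,
      ∃ u u' : Fin d → ℕ, a u ≠ a u' ∧
        (∀ k, v k ≤ u k ∧ u k ≤ v k + if k ∈ S then 1 else 0) ∧
        (∀ k, v k ≤ u' k ∧ u' k ≤ v k + if k ∈ S then 1 else 0) := by
  induction l with
  | nil => intro v S _ a ha; simp at ha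
  | cons b l ih =>
    intro v S h a ha
    obtain ⟨i, hi, hne⟩ := Finset.exists_ne_zero_of_sum_ne_zero h
    have h1 := left_ne_zero_of_mul hne
    have h2 := right_ne_zero_of_mul hne
    have key : ∀ u : Fin d → ℕ, (∀ k, (v + Pi.single i 1 : Fin d → ℕ) k ≤ u k ∧
        u k ≤ (v + Pi.single i 1 : Fin d → ℕ) k + if k ∈ S.erase i then 1 else 0) →
        (∀ k, v k ≤ u k ∧ u k ≤ v k + if k ∈ S then 1 else 0) := by
      intro u hu k
      have := hu k
      by_cases hk : k = i
      · subst hk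
        simp [hi] at this ⊢
        omega
      · simpa [hk] using this
    rcases List.mem_cons.1 ha with rfl | ha
    · refine ⟨v + Pi.single i 1, v, ?_, ?_, ?_⟩
      · intro e
        rw [e] at h1
        exact h1 (CharTwo.add_self_eq_zero _)
      · apply key
        intro k
        simp
      · intro k
        simp
    · obtain ⟨u, u', h3, h4, h5⟩ := ih _ _ h2 a ha
      exact ⟨u, u', h3, key u h4, key u' h5⟩

/-- Grid points of the `S`-face of the box. -/
def boxS {d : ℕ} (n : Fin d → ℕ) (S : Finset (Fin d)) : Finset (Fin d → ℕ) :=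
  Fintype.piFinset fun i => if i ∈ S then Finset.range (n i) else {n i}

theorem sum_boxS {d : ℕ} (n : Fin d → ℕ) (S : Finset (Fin d)) (i : Fin d) (hi : i ∈ S)
    (h : (Fin d → ℕ) → ZMod 2) :
    ∑ v ∈ boxS n S, h v =
      ∑ v ∈ boxS n (S.erase i), ∑ m ∈ Finset.range (n i), h (Function.update v i m) := by
  rw [← Finset.sum_product']
  refine Finset.sum_bij' (fun v _ => (Function.update v i (n i), v i))
    (fun x _ => Function.update x.1 i x.2) ?_ ?_ ?_ ?_ ?_
  · intro v hv
    simp only [boxS, Fintype.mem_piFinset, Finset.mem_product] at hv ⊢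
    constructor
    · intro k
      have := hv k
      by_cases hk : k = i
      · subst hk; simp
      · simpa [hk] using this
    · have := hv i
      simpa [hi] using this
  · rintro ⟨v, m⟩ hv
    simp only [boxS, Fintype.mem_piFinset, Finset.mem_product] at hv ⊢
    intro k
    have := hv.1 k
    by_cases hk : k = i
    · subst hk; simpa [hi] using hv.2
    · simpa [hk] using this
  · intro v hv; simp
  · rintro ⟨v, m⟩ hv
    simp only [boxS, Fintype.mem_piFinset, Finset.mem_product] at hv
    have := hv.1 i
    simp at this
    simp [← this]
  · intro v hv; simp

theorem sum_boxS_tele {d : ℕ} (n : Fin d → ℕ) (S : Finset (Fin d)) (i : Fin d) (hi : i ∈ S)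
    (P : (Fin d → ℕ) → ZMod 2) :
    ∑ v ∈ boxS n S, (P (v + Pi.single i 1) - P v) =
      ∑ v ∈ boxS n (S.erase i), (P v - P (Function.update v i 0)) := by
  rw [sum_boxS n S i hi]
  refine Finset.sum_congr rfl fun v hv => ?_
  have e : ∀ m, Function.update v i m + Pi.single i 1 = Function.update v i (m + 1) := by
    intro m
    ext k
    by_cases hk : k = i
    · subst hk; simp
    · simp [hk]
  simp only [e]
  rw [Finset.sum_range_sub (fun m => P (Function.update v i m))]
  have : n i = v i := by
    simp only [boxS, Fintype.mem_piFinset] at hv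
    have := hv i
    simp at this
    exact this.symm
  rw [this, Function.update_eq_self]

theorem sum_pathW {d : ℕ} (n : Fin d → ℕ) (a : Fin d → (Fin d → ℕ) → ZMod 2)
    (h0 : ∀ i v, v i = 0 → a i v = 0) (h1 : ∀ i v, v i = n i → a i v = 1) (I : List (Fin d)) :
    I.Nodup → ∑ v ∈ boxS n I.toFinset, pathW (I.map a) v I.toFinset = 1 := by
  induction I with
  | nil =>
    intro _
    have : boxS n ∅ = {n} := by
      ext v
      simp [boxS, funext_iff]
    simp [pathW, this]
  | cons j I ih =>
    intro hnd
    rw [List.nodup_cons] at hnd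
    have hj : j ∉ I.toFinset := by simpa using hnd.1
    simp only [List.map_cons, pathW_cons]
    rw [Finset.sum_comm]
    have vanish : ∀ i ∈ I, ∀ (v : Fin d → ℕ) (S : Finset (Fin d)), i ∉ S → (v i = 0 ∨ v i = n i) →
        pathW (I.map a) v S = 0 := by
      intro i hi v S hiS hv
      by_contra hne
      obtain ⟨u, u', hu, h2, h3⟩ := pathW_ne _ v S hne (a i) (List.mem_map_of_mem hi)
      have h2 := h2 i
      have h3 := h3 i
      simp only [hiS, if_false] at h2 h3
      rcases hv with hv | hv
      · exact hu (by rw [h0 i u (by omega), h0 i u' (by omega)])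
      · exact hu (by rw [h1 i u (by omega), h1 i u' (by omega)])
    rw [Finset.sum_eq_single_of_mem j (by simp)]
    · rw [sum_boxS_tele n _ j (by simp)
        (fun v => a j v * pathW (I.map a) v ((j :: I).toFinset.erase j))]
      have e : (j :: I).toFinset.erase j = I.toFinset := by
        rw [List.toFinset_cons, Finset.erase_insert hj]
      rw [e, ← ih hnd.2]
      refine Finset.sum_congr rfl fun v hv => ?_
      have hvj : v j = n j := by
        simp only [boxS, Fintype.mem_piFinset] at hv
        have := hv j
        simpa only [hj, if_false, Finset.mem_singleton] using this
      rw [h1 j v hvj, h0 j (Function.update v j 0) (by simp)]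
      ring
    · intro i hi hij
      have hiI : i ∈ I := by
        simp only [List.mem_toFinset, List.mem_cons] at hi
        tauto
      rw [sum_boxS_tele n _ i hi
        (fun v => a j v * pathW (I.map a) v ((j :: I).toFinset.erase i))]
      refine Finset.sum_eq_zero fun v hv => ?_
      have hvi : v i = n i := by
        simp only [boxS, Fintype.mem_piFinset] at hv
        have := hv i
        simpa using this
      rw [vanish i hiI v _ (by simp) (Or.inr hvi),
        vanish i hiI (Function.update v i 0) _ (by simp) (Or.inl (by simp))]
      ring

theorem grid_lemma {d : ℕ} (n : Fin d → ℕ) (a : Fin d → (Fin d → ℕ) → ZMod 2)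
    (h0 : ∀ i v, v i = 0 → a i v = 0) (h1 : ∀ i v, v i = n i → a i v = 1) :
    ∃ v : Fin d → ℕ, (∀ k, v k < n k) ∧ ∀ i, ∃ u u' : Fin d → ℕ, a i u ≠ a i u' ∧
        (∀ k, v k ≤ u k ∧ u k ≤ v k + 1) ∧ (∀ k, v k ≤ u' k ∧ u' k ≤ v k + 1) := by
  have h := sum_pathW n a h0 h1 (Finset.univ : Finset (Fin d)).toList (Finset.nodup_toList _)
  rw [Finset.toList_toFinset] at h
  obtain ⟨v, hv, hne⟩ := Finset.exists_ne_zero_of_sum_ne_zero (by rw [h]; exact one_ne_zero)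
  refine ⟨v, ?_, fun i => ?_⟩
  · intro k
    simp only [boxS, Fintype.mem_piFinset] at hv
    simpa using hv k
  · obtain ⟨u, u', hu, h2, h3⟩ := pathW_ne _ v _ hne (a i) (List.mem_map_of_mem (by simp))
    exact ⟨u, u', hu, by simpa using h2, by simpa using h3⟩

/-- Poincaré–Miranda on an integer box. -/
theorem miranda {d : ℕ} (n : Fin d → ℕ) (hn : ∀ j, 1 ≤ n j)
    (g : (Fin d → ℝ) → Fin d → ℝ) (hg : Continuous g)
    (h0 : ∀ y : Fin d → ℝ, (∀ k, 0 ≤ y k ∧ y k ≤ n k) → ∀ j, y j = 0 → g y j ≤ 0)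
    (h1 : ∀ y : Fin d → ℝ, (∀ k, 0 ≤ y k ∧ y k ≤ n k) → ∀ j, y j = n j → 0 ≤ g y j) :
    ∃ y : Fin d → ℝ, (∀ k, 0 ≤ y k ∧ y k ≤ n k) ∧ g y = 0 := by
  classical
  set K : Set (Fin d → ℝ) := Set.Icc 0 (fun k => (n k : ℝ)) with hK
  have memK : ∀ y, y ∈ K ↔ ∀ k, 0 ≤ y k ∧ y k ≤ n k := by
    intro y
    simp only [hK, Set.mem_Icc, Pi.le_def, Pi.zero_apply]
    exact forall_and.symm
  have cK : IsCompact K := isCompact_Icc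
  have neK : K.Nonempty := ⟨0, (memK 0).2 fun k => by simp⟩
  obtain ⟨y0, hy0, hmin⟩ := cK.exists_isMinOn neK (continuous_norm.comp hg).continuousOn
  refine ⟨y0, (memK _).1 hy0, ?_⟩
  by_contra hne
  have hε : 0 < ‖g y0‖ := norm_pos_iff.2 hne
  have uc := cK.uniformContinuousOn_of_continuous hg.continuousOn
  rw [Metric.uniformContinuousOn_iff] at uc
  obtain ⟨δ, hδ, uc⟩ := uc _ hε
  obtain ⟨m, hm⟩ := exists_nat_one_div_lt hδ
  set M : ℕ := m + 1 with hM
  have hM0 : (0 : ℝ) < M := by positivity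
  have hmM : 1 / (M : ℝ) < δ := by rw [hM]; push_cast; exact hm
  let pt : (Fin d → ℕ) → Fin d → ℝ := fun v k => (v k : ℝ) / M
  have ptK : ∀ v : Fin d → ℕ, (∀ k, v k ≤ n k * M) → pt v ∈ K := by
    intro v hv
    rw [memK]
    intro k
    refine ⟨by positivity, ?_⟩
    simp only [pt]
    rw [div_le_iff₀ hM0]
    exact_mod_cast hv k
  let a : Fin d → (Fin d → ℕ) → ZMod 2 := fun i v =>
    if v i = 0 then 0 else if v i = n i * M then 1 else if g (pt v) i ≤ 0 then 0 else 1
  have hpos : ∀ i, n i * M ≠ 0 := fun i => by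
    have := hn i
    positivity
  obtain ⟨v, hv, hcell⟩ := grid_lemma (fun i => n i * M) a
    (fun i v h => by simp [a, h]) (fun i v h => by
      have := hpos i
      simp only [a, h, this, if_false, if_true])
  have hvK : pt v ∈ K := ptK v fun k => (hv k).le
  have ha0 : ∀ i u, pt u ∈ K → a i u = 0 → g (pt u) i ≤ 0 := by
    intro i u hu h
    by_cases c1 : u i = 0
    · exact h0 _ ((memK _).1 hu) i (by simp [pt, c1])
    · by_cases c2 : u i = n i * M
      · simp [a, c2] at h
        have := hn i
        omega
      · by_contra c3
        simp [a, c1, c2, c3] at h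
  have ha1 : ∀ i u, pt u ∈ K → a i u ≠ 0 → 0 ≤ g (pt u) i := by
    intro i u hu h
    by_cases c1 : u i = 0
    · simp [a, c1] at h
    · by_cases c2 : u i = n i * M
      · refine h1 _ ((memK _).1 hu) i ?_
        simp only [pt, c2]
        push_cast
        field_simp
      · by_contra c3
        have c3 := (not_le.1 c3).le
        simp [a, c1, c2, c3] at h
  have close : ∀ u : Fin d → ℕ, (∀ k, v k ≤ u k ∧ u k ≤ v k + 1) →
      pt u ∈ K ∧ ∀ i, |g (pt u) i - g (pt v) i| < ‖g y0‖ := by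
    intro u hu
    have huK : pt u ∈ K := ptK u fun k => by
      have := (hu k).2
      have := hv k
      omega
    refine ⟨huK, fun i => ?_⟩
    have hd : dist (pt u) (pt v) < δ := by
      refine lt_of_le_of_lt ?_ hmM
      rw [dist_pi_le_iff (by positivity)]
      intro k
      have h1 : (v k : ℝ) ≤ u k := by exact_mod_cast (hu k).1
      have h2 : (u k : ℝ) ≤ v k + 1 := by exact_mod_cast (hu k).2
      simp only [pt]
      rw [Real.dist_eq, ← sub_div, abs_div, abs_of_pos hM0]
      gcongr
      rw [abs_le]
      constructor <;> linarith
    have := uc _ huK _ hvK hd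
    rw [dist_pi_lt_iff hε] at this
    simpa [Real.dist_eq] using this i
  have hlt : ‖g (pt v)‖ < ‖g y0‖ := by
    rw [pi_norm_lt_iff hε]
    intro i
    have two : ∃ u u' : Fin d → ℕ, a i u = 0 ∧ a i u' ≠ 0 ∧
        (∀ k, v k ≤ u k ∧ u k ≤ v k + 1) ∧ (∀ k, v k ≤ u' k ∧ u' k ≤ v k + 1) := by
      obtain ⟨u, u', hu, h2, h3⟩ := hcell i
      by_cases c : a i u = 0
      · exact ⟨u, u', c, fun e => hu (by rw [c, e]), h2, h3⟩
      · refine ⟨u', u, ?_, c, h3, h2⟩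
        generalize a i u = x at *
        generalize a i u' = y at *
        clear * - c hu
        revert x y
        decide
    obtain ⟨u, u', hu, hu', h2, h3⟩ := two
    obtain ⟨k1, b1⟩ := close u h2
    obtain ⟨k2, b2⟩ := close u' h3
    have e1 := ha0 i u k1 hu
    have e2 := ha1 i u' k2 hu'
    have b1 := abs_lt.1 (b1 i)
    have b2 := abs_lt.1 (b2 i)
    rw [Real.norm_eq_abs, abs_lt]
    constructor <;> linarith
  have := hmin hvK
  exact absurd hlt (not_lt.2 this)

/-- The hat function. -/
noncomputable def hat (s : ℝ) : ℝ := max 0 (1 - |s|)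

theorem hat_nonneg (s : ℝ) : 0 ≤ hat s := le_max_left _ _

theorem hat_eq_zero {s : ℝ} (h : 1 ≤ |s|) : hat s = 0 := max_eq_left (by linarith)

theorem hat_cont : Continuous hat := by unfold hat; fun_prop

theorem sperner_pile (d : ℕ) (n : Fin d → ℕ) (hn : ∀ j, 1 ≤ n j)
    (L : (Fin d → ℕ) → Fin d → Bool)
    (hSperner : ∀ v : Fin d → ℕ, (∀ j, v j ≤ n j) →
      ∀ j, (v j = 0 → L v j = false) ∧ (v j = n j → L v j = true)) :
    ∃ (p : Fin d → ℕ) (S : Finset (Fin d)),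
      (∀ j, (if j ∈ S then p j + 1 else p j) ≤ n j) ∧
      ∃ t : Fin d → ℝ, (∀ j ∈ S, t j ∈ Set.Ioo (0 : ℝ) 1) ∧ (∀ j ∉ S, t j = 0) ∧
        cellExt L p S t = fun _ => (1 : ℝ) / 2 := by
  classical
  let B : Finset (Fin d → ℕ) := Fintype.piFinset fun j => Finset.range (n j + 2)
  let g : (Fin d → ℝ) → Fin d → ℝ := fun y j =>
    ∑ v ∈ B, (∏ k, hat (y k - v k)) * (labelPt (L v) j - 1 / 2)
  have hg : Continuous g := by
    refine continuous_pi fun j => continuous_finsetSum _ fun v _ => ?_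
    refine Continuous.mul (continuous_finsetProd _ fun k _ => ?_) continuous_const
    exact hat_cont.comp (by fun_prop)
  -- a vertex of nonzero weight is close to `y`
  have near : ∀ (y : Fin d → ℝ) (v : Fin d → ℕ), (∏ k, hat (y k - v k)) ≠ 0 →
      ∀ k, |y k - v k| < 1 := by
    intro y v h k
    by_contra hk
    exact h (Finset.prod_eq_zero (Finset.mem_univ k) (hat_eq_zero (not_lt.1 hk)))
  have inbox : ∀ (y : Fin d → ℝ), (∀ k, 0 ≤ y k ∧ y k ≤ n k) → ∀ (v : Fin d → ℕ),
      (∏ k, hat (y k - v k)) ≠ 0 → ∀ k, v k ≤ n k := by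
    intro y hy v h k
    have h1 := abs_lt.1 (near y v h k)
    have h2 := hy k
    have : (v k : ℝ) < n k + 1 := by linarith
    have : v k < n k + 1 := by exact_mod_cast this
    omega
  have pnn : ∀ (y : Fin d → ℝ) (v : Fin d → ℕ), 0 ≤ ∏ k, hat (y k - v k) :=
    fun y v => Finset.prod_nonneg fun k _ => hat_nonneg _
  obtain ⟨y, hy, hy0⟩ := miranda n hn g hg
    (by
      intro y hy j hj
      refine Finset.sum_nonpos fun v _ => ?_
      by_cases hz : (∏ k, hat (y k - v k)) = 0
      · rw [hz, zero_mul]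
      · have hb := inbox y hy v hz
        have h1 := abs_lt.1 (near y v hz j)
        have hv : v j = 0 := by
          have : (v j : ℝ) < 1 := by linarith
          have : v j < 1 := by exact_mod_cast this
          omega
        have := (hSperner v hb j).1 hv
        refine mul_nonpos_of_nonneg_of_nonpos (pnn y v) ?_
        simp [labelPt, this])
    (by
      intro y hy j hj
      refine Finset.sum_nonneg fun v _ => ?_
      by_cases hz : (∏ k, hat (y k - v k)) = 0
      · rw [hz, zero_mul]
      · have hb := inbox y hy v hz
        have h1 := abs_lt.1 (near y v hz j)
        have hv : v j = n j := by
          have : (n j : ℝ) < v j + 1 := by linarith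
          have : n j < v j + 1 := by exact_mod_cast this
          have := hb j
          omega
        have := (hSperner v hb j).2 hv
        refine mul_nonneg (pnn y v) ?_
        norm_num [labelPt, this])
  let p : Fin d → ℕ := fun j => ⌊y j⌋₊
  let t : Fin d → ℝ := fun j => y j - p j
  have ht0 : ∀ j, 0 ≤ t j := fun j => sub_nonneg.2 (Nat.floor_le (hy j).1)
  have ht1 : ∀ j, t j < 1 := fun j => by
    have := Nat.lt_floor_add_one (y j)
    simp only [t, p]
    linarith
  let S : Finset (Fin d) := Finset.univ.filter fun j => t j ≠ 0
  have hpn : ∀ j, p j ≤ n j := fun j => by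
    have := Nat.floor_le_floor (hy j).2
    simpa [p] using this
  refine ⟨p, S, ?_, t, ?_, ?_, ?_⟩
  · intro j
    split_ifs with hj
    · have hj : t j ≠ 0 := by simpa [S] using hj
      have h1 : 0 < t j := lt_of_le_of_ne (ht0 j) (Ne.symm hj)
      have h2 := (hy j).2
      have : (p j : ℝ) < n j := by simp only [t] at h1; linarith
      have : p j < n j := by exact_mod_cast this
      omega
    · exact hpn j
  · intro j hj
    have hj : t j ≠ 0 := by simpa [S] using hj
    exact ⟨lt_of_le_of_ne (ht0 j) (Ne.symm hj), ht1 j⟩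
  · intro j hj
    simpa [S] using hj
  · have wt : ∀ w : Fin d → Bool,
        (∏ j, if j ∈ S then (if w j then t j else 1 - t j) else (if w j then (0 : ℝ) else 1))
          = ∏ j, if w j then t j else 1 - t j := by
      intro w
      refine Finset.prod_congr rfl fun j _ => ?_
      split_ifs with h1 h2 h2
      · rfl
      · rfl
      · have : t j = 0 := by simpa [S] using h1
        rw [this]
      · have : t j = 0 := by simpa [S] using h1
        rw [this, sub_zero]
    have wt2 : ∀ w : Fin d → Bool, (∏ j, if w j then t j else 1 - t j) =
        ∏ k, hat (y k - ((p k + if w k then 1 else 0 : ℕ) : ℝ)) := by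
      intro w
      refine Finset.prod_congr rfl fun j _ => ?_
      have e0 := ht0 j
      have e1 := ht1 j
      have ey : y j = p j + t j := by simp only [t]; ring
      rw [ey]
      unfold hat
      split_ifs with h
      · push_cast
        rw [abs_of_nonpos (by linarith), max_eq_right (by linarith)]
        ring
      · push_cast
        rw [abs_of_nonneg (by linarith), max_eq_right (by linarith)]
        ring
    have total : ∑ w : Fin d → Bool, (∏ j, if w j then t j else 1 - t j) = 1 := by
      have := Finset.prod_univ_sum (fun _ : Fin d => (Finset.univ : Finset Bool))
        (fun j b => if b then t j else 1 - t j)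
      rw [Fintype.piFinset_univ] at this
      rw [← this]
      simp
    ext j
    have hz : g y j = 0 := by rw [hy0]; rfl
    have reindex : g y j = ∑ w : Fin d → Bool, (∏ j, if w j then t j else 1 - t j) *
        (labelPt (L fun j => p j + if w j then 1 else 0) j - 1 / 2) := by
      symm
      refine Finset.sum_of_injOn (fun w => fun j => p j + if w j then 1 else 0) ?_ ?_ ?_ ?_
      · intro w _ w' _ h
        ext k
        have := congrFun h k
        simp only at this
        cases h1 : w k <;> cases h2 : w' k <;> simp [h1, h2] at this ⊢
      · intro w _
        simp only [B, Finset.mem_coe, Fintype.mem_piFinset, Finset.mem_range]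
        intro k
        have := hpn k
        split_ifs <;> omega
      · intro v _ hv
        by_cases hz : (∏ k, hat (y k - v k)) = 0
        · rw [hz, zero_mul]
        · exfalso
          apply hv
          refine ⟨fun k => decide (v k = p k + 1), by simp, ?_⟩
          ext k
          have h1 := abs_lt.1 (near y v hz k)
          have e0 := ht0 k
          have e1 := ht1 k
          simp only [t] at e0 e1
          have h2 : (v k : ℝ) < p k + 2 := by linarith
          have h3 : (p k : ℝ) < v k + 1 := by linarith
          have h2 : v k < p k + 2 := by exact_mod_cast h2
          have h3 : p k < v k + 1 := by exact_mod_cast h3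
          by_cases c : v k = p k + 1
          · simp [c]
          · simp [c]; omega
      · intro w _
        rw [wt2 w]
    rw [hz] at reindex
    simp only [mul_sub, Finset.sum_sub_distrib] at reindex
    rw [← Finset.sum_mul, total] at reindex
    simp only [cellExt, Finset.sum_apply, Pi.smul_apply, smul_eq_mul, wt]
    linarith
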